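/- Let m, n ≥ 1 and let ρ : ℚ[u_1,…,u_m, v_1,…,v_n] → ℚ[u_1,…,u_{m−1}, v_1,…,v_{n−1}] be the ℚ-algebra homomorphism sending u_m ↦ 0, v_n ↦ 0 and fixing the remaining variables. Then (i) ρ maps Λ(m|n) onto Λ(m−1|n−1), and (ii) the kernel of the restriction of ρ to Λ(m|n) equals the set of products (∏_{i=1}^m ∏_{j=1}^n (u_i + v_j)) · Q, where Q ranges over all polynomials in ℚ[u_1,…,u_m, v_1,…,v_n] that are symmetric in u_1,…,u_m and symmetric in v_1,…,v_n. In particular, every such product (∏_{i,j} (u_i + v_j)) · Q with Q bisymmetric is supersymmetric. -/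

import Mathlib

/-- Symmetry in the variables `u_1, …, u_m` (the `Sum.inl` variables). -/
def IsUSymmetric (m n : ℕ) (P : MvPolynomial (Fin m ⊕ Fin n) ℚ) : Prop :=
  ∀ σ : Equiv.Perm (Fin m), MvPolynomial.rename (Sum.map σ id) P = P

/-- Symmetry in the variables `v_1, …, v_n` (the `Sum.inr` variables). -/
def IsVSymmetric (m n : ℕ) (P : MvPolynomial (Fin m ⊕ Fin n) ℚ) : Prop :=
  ∀ τ : Equiv.Perm (Fin n), MvPolynomial.rename (Sum.map id τ) P = P

/-- A bisymmetric polynomial: symmetric in the `u`'s and symmetric in the `v`'s. -/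
def IsBisymmetric (m n : ℕ) (P : MvPolynomial (Fin m ⊕ Fin n) ℚ) : Prop :=
  IsUSymmetric m n P ∧ IsVSymmetric m n P

/-- Substitution `u_i = t`, `v_j = -t`, leaving all other variables untouched. -/
noncomputable def substT (m n : ℕ) (i : Fin m) (j : Fin n) :
    MvPolynomial (Fin m ⊕ Fin n) ℚ →ₐ[ℚ]
      Polynomial (MvPolynomial (Fin m ⊕ Fin n) ℚ) :=
  MvPolynomial.aeval fun s => match s with
    | Sum.inl i' =>
        if i' = i then Polynomial.X else Polynomial.C (MvPolynomial.X (Sum.inl i'))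
    | Sum.inr j' =>
        if j' = j then -Polynomial.X else Polynomial.C (MvPolynomial.X (Sum.inr j'))

/-- A polynomial in `ℚ[u_1,…,u_m, v_1,…,v_n]` is supersymmetric if it is symmetric in
the `u`'s, symmetric in the `v`'s, and the result of substituting `u_i = t`, `v_j = -t`
is independent of `t` (for symmetric polynomials this condition does not depend on the
choice of the pair `(i,j)`, and it is vacuous when `m = 0` or `n = 0`). -/
def IsSupersymmetric (m n : ℕ) (P : MvPolynomial (Fin m ⊕ Fin n) ℚ) : Prop :=
  IsUSymmetric m n P ∧ IsVSymmetric m n P ∧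
    ∀ (i : Fin m) (j : Fin n), ∃ c, substT m n i j P = Polynomial.C c

/-- The homomorphism `ρ : ℚ[u_1,…,u_{m+1}, v_1,…,v_{n+1}] → ℚ[u_1,…,u_m, v_1,…,v_n]`
sending the last variables `u_{m+1} ↦ 0`, `v_{n+1} ↦ 0` and fixing the remaining ones. -/
noncomputable def rho (m n : ℕ) :
    MvPolynomial (Fin (m + 1) ⊕ Fin (n + 1)) ℚ →ₐ[ℚ] MvPolynomial (Fin m ⊕ Fin n) ℚ :=
  MvPolynomial.aeval fun s => match s with
    | Sum.inl i => if h : (i : ℕ) < m then MvPolynomial.X (Sum.inl ⟨i, h⟩) else 0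
    | Sum.inr j => if h : (j : ℕ) < n then MvPolynomial.X (Sum.inr ⟨j, h⟩) else 0

/-- `∏_{i=1}^{m+1} ∏_{j=1}^{n+1} (u_i + v_j)`. -/
noncomputable def uvProd (m n : ℕ) : MvPolynomial (Fin (m + 1) ⊕ Fin (n + 1)) ℚ :=
  ∏ i : Fin (m + 1), ∏ j : Fin (n + 1),
    (MvPolynomial.X (Sum.inl i) + MvPolynomial.X (Sum.inr j))

/-- The power series `∏_i (1 + u_i X) / ∏_j (1 - v_j X)`. -/
noncomputable def superGen {R ι κ : Type*} [CommRing R] [Fintype ι] [Fintype κ]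
    (u : ι → R) (v : κ → R) : PowerSeries R :=
  (∏ i, (1 + PowerSeries.C (u i) * PowerSeries.X)) * ∏ j, PowerSeries.mk fun k => v j ^ k

section PowerSeries

variable {R : Type*} [CommRing R]

lemma mk_pow_mul_one_sub (a : R) :
    PowerSeries.mk (fun k => a ^ k) * (1 - PowerSeries.C a * PowerSeries.X) = 1 := by
  ext k
  rw [mul_sub, mul_one, mul_left_comm, ← mul_assoc, map_sub]
  cases k with
  | zero => simp
  | succ k =>
    rw [mul_assoc, PowerSeries.coeff_C_mul, PowerSeries.coeff_succ_mul_X]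
    simp [PowerSeries.coeff_one, pow_succ']

lemma map_superGen {S ι κ : Type*} [CommRing S] [Fintype ι] [Fintype κ] (f : R →+* S)
    (u : ι → R) (v : κ → R) :
    PowerSeries.map f (superGen u v) = superGen (f ∘ u) (f ∘ v) := by
  have h (a : R) : PowerSeries.map f (PowerSeries.mk fun k => a ^ k) =
      PowerSeries.mk fun k => f a ^ k := by
    ext k; simp
  simp [superGen, map_prod, h]

lemma superGen_comp_equiv {ι κ : Type*} [Fintype ι] [Fintype κ]
    (u : ι → R) (v : κ → R) (σ : Equiv.Perm ι) (τ : Equiv.Perm κ) :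
    superGen (u ∘ σ) (v ∘ τ) = superGen u v := by
  unfold superGen
  congr 1
  · exact Equiv.prod_comp σ fun i => 1 + PowerSeries.C (u i) * PowerSeries.X
  · exact Equiv.prod_comp τ fun j => PowerSeries.mk fun k => v j ^ k

lemma superGen_eq_of_add_eq_zero {ι κ : Type*} [Fintype ι] [Fintype κ] [DecidableEq ι]
    [DecidableEq κ] (u : ι → R) (v : κ → R) (i : ι) (j : κ) (h : v j = -u i) :
    superGen u v = (∏ p ∈ Finset.univ.erase i, (1 + PowerSeries.C (u p) * PowerSeries.X)) *
      ∏ q ∈ Finset.univ.erase j, PowerSeries.mk fun k => v q ^ k := by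
  have h1 := mk_pow_mul_one_sub (v j)
  rw [h, map_neg, neg_mul, sub_neg_eq_add] at h1
  rw [superGen, ← Finset.mul_prod_erase _ _ (Finset.mem_univ i),
    ← Finset.mul_prod_erase Finset.univ (fun j => PowerSeries.mk fun k => v j ^ k)
      (Finset.mem_univ j), mul_mul_mul_comm, mul_comm (1 + _), h, h1, one_mul]

lemma superGen_castSucc {m n : ℕ} (u : Fin (m + 1) → R) (v : Fin (n + 1) → R)
    (hu : u (Fin.last m) = 0) (hv : v (Fin.last n) = 0) :
    superGen u v = superGen (u ∘ Fin.castSucc) (v ∘ Fin.castSucc) := by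
  have h : (PowerSeries.mk fun k => (0 : R) ^ k) = 1 := by
    simpa using mk_pow_mul_one_sub (0 : R)
  simp [superGen, Fin.prod_univ_castSucc, hu, hv, h]

lemma superGen_mul_prod {ι κ : Type*} [Fintype ι] [Fintype κ] (u : ι → R) (v : κ → R) :
    superGen u v * ∏ j, (1 - PowerSeries.C (v j) * PowerSeries.X) =
      ∏ i, (1 + PowerSeries.C (u i) * PowerSeries.X) := by
  rw [superGen, mul_assoc, ← Finset.prod_mul_distrib]
  simp [mk_pow_mul_one_sub]

lemma superGen_mul_prod_erase {ι κ : Type*} [Fintype ι] [Fintype κ] [DecidableEq κ]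
    (u : ι → R) (v : κ → R) (l : κ) :
    superGen u v * ∏ j ∈ Finset.univ.erase l, (1 - PowerSeries.C (v j) * PowerSeries.X) =
      (∏ i, (1 + PowerSeries.C (u i) * PowerSeries.X)) * PowerSeries.mk fun k => v l ^ k := by
  rw [superGen, ← Finset.mul_prod_erase Finset.univ (fun j => PowerSeries.mk fun k => v j ^ k)
      (Finset.mem_univ l), mul_assoc, mul_assoc, ← Finset.prod_mul_distrib]
  simp [mk_pow_mul_one_sub]

lemma coeff_prod_one_add_mul_mk {ι : Type*} (s : Finset ι) (u : ι → R) (a : R) (k : ℕ) :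
    PowerSeries.coeff (s.card + k) ((∏ i ∈ s, (1 + PowerSeries.C (u i) * PowerSeries.X)) *
      PowerSeries.mk fun k => a ^ k) = a ^ k * ∏ i ∈ s, (u i + a) := by
  classical
  induction s using Finset.induction_on generalizing k with
  | empty => simp
  | insert i s hi ih =>
    rw [Finset.prod_insert hi, Finset.prod_insert hi, Finset.card_insert_of_notMem hi, mul_assoc,
      add_mul, one_mul, map_add, mul_assoc, PowerSeries.coeff_C_mul, add_right_comm,
      mul_comm PowerSeries.X, PowerSeries.coeff_succ_mul_X, ih, add_assoc, ih]
    ring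

lemma coeff_prod_one_add {ι : Type*} [Fintype ι] (u : ι → R) (k : ℕ) :
    PowerSeries.coeff k (∏ i, (1 + PowerSeries.C (u i) * PowerSeries.X)) =
      ∑ t ∈ Finset.powersetCard k Finset.univ, ∏ i ∈ t, u i := by
  rw [Finset.prod_one_add, map_sum, Finset.powersetCard_eq_filter, Finset.sum_filter]
  refine Finset.sum_congr rfl fun t _ => ?_
  rw [Finset.prod_mul_distrib, Finset.prod_const, ← map_prod, PowerSeries.coeff_C_mul,
    PowerSeries.coeff_X_pow]
  simp [eq_comm]

end PowerSeries

section Determinants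

variable {R : Type*} [CommRing R] {m n : ℕ}

/-- The coefficients of `∏_{j ≠ l} (1 - v_j X)`, arranged as the columns of a square matrix. -/
noncomputable def prodEraseMatrix (v : Fin n → R) : Matrix (Fin n) (Fin n) R :=
  Matrix.of fun j l =>
    PowerSeries.coeff j (∏ p ∈ Finset.univ.erase l, (1 - PowerSeries.C (v p) * PowerSeries.X))

/-- The Jacobi-Trudi type matrix of coefficients of `superGen u v`. -/
noncomputable def jacobiTrudi (u : Fin m → R) (v : Fin n → R) (κ : Fin n → ℕ) :
    Matrix (Fin n) (Fin n) R :=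
  Matrix.of fun i j => PowerSeries.coeff (m + κ i) (PowerSeries.X ^ (j : ℕ) * superGen u v)

lemma sum_coeff_mul_X_pow_prod_erase (v : Fin n → R) (l : Fin n) :
    ∑ j : Fin n, PowerSeries.C (prodEraseMatrix v j l) * PowerSeries.X ^ (j : ℕ) =
      ∏ p ∈ Finset.univ.erase l, (1 - PowerSeries.C (v p) * PowerSeries.X) := by
  set g : Polynomial R := ∏ p ∈ Finset.univ.erase l, (1 - Polynomial.C (v p) * Polynomial.X)
    with hg
  have hcoe : (g : PowerSeries R) =
      ∏ p ∈ Finset.univ.erase l, (1 - PowerSeries.C (v p) * PowerSeries.X) := by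
    rw [hg, ← Polynomial.coeToPowerSeries.ringHom_apply, map_prod]
    simp
  have hdeg : g.natDegree < n := by
    refine lt_of_le_of_lt (Polynomial.natDegree_prod_le _ _) ?_
    refine lt_of_le_of_lt (Finset.sum_le_card_nsmul _ _ 1 fun p _ => ?_) ?_
    · refine (Polynomial.natDegree_sub_le _ _).trans ?_
      simpa using (Polynomial.natDegree_C_mul_le (v p) Polynomial.X).trans
        Polynomial.natDegree_X_le
    · have := l.pos
      simp only [Finset.mem_univ, Finset.card_erase_of_mem, Finset.card_univ, Fintype.card_fin,
        smul_eq_mul, mul_one]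
      omega
  conv_rhs => rw [← hcoe, g.as_sum_range' n hdeg, ← Fin.sum_univ_eq_sum_range
    (fun j => Polynomial.monomial j (g.coeff j)), ← Polynomial.coeToPowerSeries.ringHom_apply,
    map_sum]
  refine Finset.sum_congr rfl fun j _ => ?_
  rw [← Polynomial.C_mul_X_pow_eq_monomial]
  simp [prodEraseMatrix, ← hcoe]

lemma jacobiTrudi_mul (u : Fin m → R) (v : Fin n → R) (κ : Fin n → ℕ) :
    jacobiTrudi u v κ * prodEraseMatrix v =
      Matrix.of fun i l => (∏ p, (u p + v l)) * Matrix.of (fun i l => v l ^ κ i) i l := by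
  ext i l
  have h := superGen_mul_prod_erase u v l
  rw [← sum_coeff_mul_X_pow_prod_erase, Finset.mul_sum] at h
  have h' := congrArg (PowerSeries.coeff (m + κ i)) h
  have h2 := coeff_prod_one_add_mul_mk Finset.univ u (v l) (κ i)
  rw [Finset.card_univ, Fintype.card_fin] at h2
  rw [h2, map_sum] at h'
  rw [Matrix.mul_apply, Matrix.of_apply, Matrix.of_apply, mul_comm, ← h']
  refine Finset.sum_congr rfl fun j _ => ?_
  rw [mul_left_comm, PowerSeries.coeff_C_mul, mul_comm, mul_comm (superGen u v)]
  rfl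

lemma det_jacobiTrudi_mul (u : Fin m → R) (v : Fin n → R) (κ : Fin n → ℕ) :
    (jacobiTrudi u v κ).det * (prodEraseMatrix v).det =
      (∏ p, ∏ l, (u p + v l)) * (Matrix.of fun i l => v l ^ κ i).det := by
  rw [← Matrix.det_mul, jacobiTrudi_mul, Matrix.det_mul_row, Finset.prod_comm]

lemma det_prodEraseMatrix (v : Fin n → R) :
    (prodEraseMatrix v).det = (Matrix.vandermonde v).det := by
  have h := det_jacobiTrudi_mul (Fin.elim0 : Fin 0 → R) v Fin.val
  have h1 : (jacobiTrudi (Fin.elim0 : Fin 0 → R) v Fin.val).det = 1 := by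
    rw [Matrix.det_of_isLowerTriangular]
    · simp [jacobiTrudi, PowerSeries.coeff_X_pow_mul', superGen]
    · intro i j hij
      have hij : i < j := hij
      simp [jacobiTrudi, PowerSeries.coeff_X_pow_mul', hij]
  rw [h1, one_mul] at h
  rw [h, ← Matrix.det_transpose (Matrix.vandermonde v), Finset.univ_eq_empty, Finset.prod_empty,
    one_mul]
  rfl

end Determinants

section Generators

variable {m n : ℕ}

/-- The supersymmetric polynomials, as a subalgebra. -/
noncomputable def supersymmetricSubalgebra (m n : ℕ) :
    Subalgebra ℚ (MvPolynomial (Fin m ⊕ Fin n) ℚ) where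
  carrier := {P | IsSupersymmetric m n P}
  mul_mem' := by
    rintro P Q ⟨hPu, hPv, hP⟩ ⟨hQu, hQv, hQ⟩
    refine ⟨fun σ => by rw [map_mul, hPu, hQu], fun τ => by rw [map_mul, hPv, hQv], fun i j => ?_⟩
    obtain ⟨c, hc⟩ := hP i j
    obtain ⟨d, hd⟩ := hQ i j
    exact ⟨c * d, by rw [map_mul, hc, hd, map_mul]⟩
  add_mem' := by
    rintro P Q ⟨hPu, hPv, hP⟩ ⟨hQu, hQv, hQ⟩
    refine ⟨fun σ => by rw [map_add, hPu, hQu], fun τ => by rw [map_add, hPv, hQv], fun i j => ?_⟩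
    obtain ⟨c, hc⟩ := hP i j
    obtain ⟨d, hd⟩ := hQ i j
    exact ⟨c + d, by rw [map_add, hc, hd, map_add]⟩
  algebraMap_mem' r := by
    refine ⟨fun σ => AlgHom.commutes _ r, fun τ => AlgHom.commutes _ r, fun i j => ?_⟩
    exact ⟨algebraMap ℚ _ r, AlgHom.commutes _ r⟩

/-- The coefficients of the series `∏_i (1 + u_i X) / ∏_j (1 - v_j X)`, which are the
supersymmetric analogues of the elementary symmetric polynomials. -/
noncomputable def superElementary (m n k : ℕ) : MvPolynomial (Fin m ⊕ Fin n) ℚ :=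
  PowerSeries.coeff k
    (superGen (fun i => MvPolynomial.X (Sum.inl i)) fun j => MvPolynomial.X (Sum.inr j))

lemma map_superElementary {S : Type*} [CommRing S] [Algebra ℚ S]
    (f : MvPolynomial (Fin m ⊕ Fin n) ℚ →ₐ[ℚ] S) (k : ℕ) :
    f (superElementary m n k) = PowerSeries.coeff k
      (superGen (fun i => f (MvPolynomial.X (Sum.inl i)))
        fun j => f (MvPolynomial.X (Sum.inr j))) := by
  have h := congrArg (PowerSeries.coeff k) (map_superGen f.toRingHom
    (fun i : Fin m => MvPolynomial.X (Sum.inl i)) fun j : Fin n => MvPolynomial.X (Sum.inr j))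
  rw [PowerSeries.coeff_map] at h
  exact h

lemma isSupersymmetric_superElementary (k : ℕ) :
    IsSupersymmetric m n (superElementary m n k) := by
  refine ⟨fun σ => ?_, fun τ => ?_, fun i j => ?_⟩
  · rw [map_superElementary]
    simp only [MvPolynomial.rename_X, Sum.map_inl, Sum.map_inr, id]
    exact congrArg _ (superGen_comp_equiv (fun i => MvPolynomial.X (Sum.inl i))
      (fun j => MvPolynomial.X (Sum.inr j)) σ 1)
  · rw [map_superElementary]
    simp only [MvPolynomial.rename_X, Sum.map_inl, Sum.map_inr, id]
    exact congrArg _ (superGen_comp_equiv (fun i => MvPolynomial.X (Sum.inl i))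
      (fun j => MvPolynomial.X (Sum.inr j)) 1 τ)
  · refine ⟨PowerSeries.coeff k ((∏ p ∈ Finset.univ.erase i,
      (1 + PowerSeries.C (MvPolynomial.X (Sum.inl p)) * PowerSeries.X)) *
      ∏ q ∈ Finset.univ.erase j, PowerSeries.mk fun k => MvPolynomial.X (Sum.inr q) ^ k), ?_⟩
    have hmk (a : MvPolynomial (Fin m ⊕ Fin n) ℚ) :
        PowerSeries.map Polynomial.C (PowerSeries.mk fun k => a ^ k) =
          PowerSeries.mk fun k => Polynomial.C a ^ k := by
      ext k : 1; simp
    rw [map_superElementary, superGen_eq_of_add_eq_zero _ _ i j (by simp [substT]),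
      ← PowerSeries.coeff_map, map_mul (PowerSeries.map _),
      map_prod (PowerSeries.map _), map_prod (PowerSeries.map _)]
    refine congrArg _ (congrArg₂ _ (Finset.prod_congr rfl fun p hp => ?_)
      (Finset.prod_congr rfl fun q hq => ?_))
    · simp [substT, Finset.ne_of_mem_erase hp]
    · simp [substT, Finset.ne_of_mem_erase hq, hmk]

/-- The subalgebra generated by the supersymmetric elementary polynomials. -/
noncomputable def elementarySubalgebra (m n : ℕ) :
    Subalgebra ℚ (MvPolynomial (Fin m ⊕ Fin n) ℚ) :=
  Algebra.adjoin ℚ (Set.range (superElementary m n))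

lemma superElementary_mem (k : ℕ) : superElementary m n k ∈ elementarySubalgebra m n :=
  Algebra.subset_adjoin ⟨k, rfl⟩

lemma elementarySubalgebra_le : elementarySubalgebra m n ≤ supersymmetricSubalgebra m n := by
  refine Algebra.adjoin_le ?_
  rintro _ ⟨k, rfl⟩
  exact isSupersymmetric_superElementary k

@[simp] lemma rho_X_inl_castSucc (i : Fin m) :
    rho m n (MvPolynomial.X (Sum.inl i.castSucc)) = MvPolynomial.X (Sum.inl i) := by
  simp [rho]

@[simp] lemma rho_X_inr_castSucc (j : Fin n) :
    rho m n (MvPolynomial.X (Sum.inr j.castSucc)) = MvPolynomial.X (Sum.inr j) := by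
  simp [rho]

@[simp] lemma rho_X_inl_last : rho m n (MvPolynomial.X (Sum.inl (Fin.last m))) = 0 := by
  simp [rho]

@[simp] lemma rho_X_inr_last : rho m n (MvPolynomial.X (Sum.inr (Fin.last n))) = 0 := by
  simp [rho]

lemma rho_superElementary (k : ℕ) :
    rho m n (superElementary (m + 1) (n + 1) k) = superElementary m n k := by
  rw [map_superElementary, superGen_castSucc _ _ (by simp) (by simp)]
  simp [superElementary, Function.comp_def]

lemma map_rho_elementarySubalgebra :
    (elementarySubalgebra (m + 1) (n + 1)).map (rho m n) = elementarySubalgebra m n := by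
  rw [elementarySubalgebra, AlgHom.map_adjoin, ← Set.range_comp]
  congr 2
  ext k : 1
  exact rho_superElementary k

/-- The extension of a permutation of `Fin k` fixing the last element of `Fin (k + 1)`. -/
def extendLast {k : ℕ} (σ : Equiv.Perm (Fin k)) : Equiv.Perm (Fin (k + 1)) :=
  (finSuccEquivLast.trans (Equiv.optionCongr σ)).trans finSuccEquivLast.symm

@[simp] lemma extendLast_castSucc {k : ℕ} (σ : Equiv.Perm (Fin k)) (i : Fin k) :
    extendLast σ i.castSucc = (σ i).castSucc := by
  simp [extendLast]

@[simp] lemma extendLast_last {k : ℕ} (σ : Equiv.Perm (Fin k)) :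
    extendLast σ (Fin.last k) = Fin.last k := by
  simp [extendLast]

lemma IsSupersymmetric.rho {P : MvPolynomial (Fin (m + 1) ⊕ Fin (n + 1)) ℚ}
    (hP : IsSupersymmetric (m + 1) (n + 1) P) : IsSupersymmetric m n (rho m n P) := by
  obtain ⟨hu, hv, hs⟩ := hP
  refine ⟨fun σ => ?_, fun τ => ?_, fun i j => ?_⟩
  · have h : (MvPolynomial.rename (Sum.map σ id)).comp (_root_.rho m n) =
        (_root_.rho m n).comp (MvPolynomial.rename (Sum.map (extendLast σ) id)) := by
      ext (i | j) : 2
      · induction i using Fin.lastCases <;> simp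
      · induction j using Fin.lastCases <;> simp
    conv_rhs => rw [← hu (extendLast σ)]
    exact DFunLike.congr_fun h P
  · have h : (MvPolynomial.rename (Sum.map id τ)).comp (_root_.rho m n) =
        (_root_.rho m n).comp (MvPolynomial.rename (Sum.map id (extendLast τ))) := by
      ext (i | j) : 2
      · induction i using Fin.lastCases <;> simp
      · induction j using Fin.lastCases <;> simp
    conv_rhs => rw [← hv (extendLast τ)]
    exact DFunLike.congr_fun h P
  · have h : (substT m n i j).comp (_root_.rho m n) =
        (Polynomial.mapAlgHom (_root_.rho m n)).comp
          (substT (m + 1) (n + 1) i.castSucc j.castSucc) := by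
      ext (p | q) : 2
      · induction p using Fin.lastCases with
        | last => simp [substT, (Fin.castSucc_ne_last i).symm]
        | cast p => by_cases hp : p = i <;> simp [substT, hp]
      · induction q using Fin.lastCases with
        | last => simp [substT, (Fin.castSucc_ne_last j).symm]
        | cast q => by_cases hq : q = j <;> simp [substT, hq]
    obtain ⟨c, hc⟩ := hs i.castSucc j.castSucc
    refine ⟨_root_.rho m n c, ?_⟩
    have h' := DFunLike.congr_fun h P
    simp only [AlgHom.comp_apply, hc] at h'
    rw [h']
    simp

end Generators

section Divisibility

open MvPolynomial

variable {m n : ℕ}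

/-- The substitution `v_j = -u_i`. -/
noncomputable def substNeg (i : Fin m) (j : Fin n) :
    MvPolynomial (Fin m ⊕ Fin n) ℚ →ₐ[ℚ] MvPolynomial (Fin m ⊕ Fin n) ℚ :=
  aeval (Function.update X (Sum.inr j) (-X (Sum.inl i)))

lemma X_add_X_dvd_iff (i : Fin m) (j : Fin n) (P : MvPolynomial (Fin m ⊕ Fin n) ℚ) :
    X (Sum.inl i) + X (Sum.inr j) ∣ P ↔ substNeg i j P = 0 := by
  constructor
  · rintro ⟨Q, rfl⟩
    simp [substNeg]
  · intro h
    let I : Ideal (MvPolynomial (Fin m ⊕ Fin n) ℚ) := Ideal.span {X (Sum.inl i) + X (Sum.inr j)}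
    have hI : (Ideal.Quotient.mkₐ ℚ I).comp (substNeg i j) = Ideal.Quotient.mkₐ ℚ I := by
      ext s : 1
      by_cases hs : s = Sum.inr j
      · subst hs
        simp only [AlgHom.comp_apply, substNeg, aeval_X, Function.update_self,
          Ideal.Quotient.mkₐ_eq_mk]
        rw [Ideal.Quotient.eq, Ideal.mem_span_singleton]
        exact ⟨-1, by ring⟩
      · simp [substNeg, hs]
    have h' := DFunLike.congr_fun hI P
    rw [AlgHom.comp_apply, h, map_zero, Ideal.Quotient.mkₐ_eq_mk] at h'
    rw [← Ideal.mem_span_singleton]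
    exact Ideal.Quotient.eq_zero_iff_mem.1 h'.symm

lemma prime_X_add_X (i : Fin m) (j : Fin n) :
    Prime (X (Sum.inl i) + X (Sum.inr j) : MvPolynomial (Fin m ⊕ Fin n) ℚ) := by
  refine ⟨fun h => ?_, fun h => ?_, fun P Q h => ?_⟩
  · simpa using congrArg (eval fun _ => (1 : ℚ)) h
  · have h1 := (X_add_X_dvd_iff i j 1).1 h.dvd
    simp at h1
  · simpa only [X_add_X_dvd_iff, map_mul, mul_eq_zero] using h

lemma not_X_add_X_dvd {i k : Fin m} {j l : Fin n} (h : (i, j) ≠ (k, l)) :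
    ¬ (X (Sum.inl i) + X (Sum.inr j) : MvPolynomial (Fin m ⊕ Fin n) ℚ) ∣
      X (Sum.inl k) + X (Sum.inr l) := by
  rintro ⟨Q, hQ⟩
  have h' := congrArg (eval (Sum.elim (fun p => if p = i then (1 : ℚ) else 2)
    fun q => if q = j then -1 else 2)) hQ
  simp only [map_add, map_mul, eval_X, Sum.elim_inl, Sum.elim_inr, if_true, add_neg_cancel,
    zero_mul] at h'
  by_cases hk : k = i <;> by_cases hl : l = j
  · exact h (by rw [hk, hl])
  all_goals norm_num [hk, hl] at h'

lemma prod_X_add_X_dvd {P : MvPolynomial (Fin m ⊕ Fin n) ℚ}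
    (h : ∀ i j, X (Sum.inl i) + X (Sum.inr j) ∣ P) :
    ∏ i : Fin m, ∏ j : Fin n, (X (Sum.inl i) + X (Sum.inr j)) ∣ P := by
  rw [← Finset.prod_product']
  refine Finset.prod_dvd_of_isRelPrime ?_ fun p _ => h p.1 p.2
  intro p _ q _ hpq
  exact (prime_X_add_X p.1 p.2).irreducible.isRelPrime_iff_not_dvd.2 (not_X_add_X_dvd hpq)

lemma prod_X_add_X_ne_zero :
    (∏ i : Fin m, ∏ j : Fin n, (X (Sum.inl i) + X (Sum.inr j)) :
      MvPolynomial (Fin m ⊕ Fin n) ℚ) ≠ 0 :=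
  Finset.prod_ne_zero_iff.2 fun i _ => Finset.prod_ne_zero_iff.2 fun j _ =>
    (prime_X_add_X i j).ne_zero

lemma isBisymmetric_prod_X_add_X :
    IsBisymmetric m n (∏ i : Fin m, ∏ j : Fin n, (X (Sum.inl i) + X (Sum.inr j))) := by
  refine ⟨fun σ => ?_, fun τ => ?_⟩
  · simp only [map_prod, map_add, rename_X, Sum.map_inl, Sum.map_inr, id]
    exact Equiv.prod_comp σ fun i => ∏ j : Fin n,
      (X (Sum.inl i) + X (Sum.inr j) : MvPolynomial (Fin m ⊕ Fin n) ℚ)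
  · simp only [map_prod, map_add, rename_X, Sum.map_inl, Sum.map_inr, id]
    exact Finset.prod_congr rfl fun i _ => Equiv.prod_comp τ fun j =>
      (X (Sum.inl i) + X (Sum.inr j) : MvPolynomial (Fin m ⊕ Fin n) ℚ)

lemma isSupersymmetric_uvProd_mul {Q : MvPolynomial (Fin (m + 1) ⊕ Fin (n + 1)) ℚ}
    (hQ : IsBisymmetric (m + 1) (n + 1) Q) :
    IsSupersymmetric (m + 1) (n + 1) (uvProd m n * Q) := by
  obtain ⟨hu, hv⟩ := isBisymmetric_prod_X_add_X (m := m + 1) (n := n + 1)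
  refine ⟨fun σ => ?_, fun τ => ?_, fun i j => ⟨0, ?_⟩⟩
  · rw [map_mul, hQ.1, uvProd, hu]
  · rw [map_mul, hQ.2, uvProd, hv]
  · have h : substT (m + 1) (n + 1) i j (uvProd m n) = 0 := by
      rw [uvProd, map_prod]
      refine Finset.prod_eq_zero (Finset.mem_univ i) ?_
      rw [map_prod]
      exact Finset.prod_eq_zero (Finset.mem_univ j) (by simp [substT])
    rw [map_mul, h, zero_mul, map_zero]

lemma rho_uvProd : rho m n (uvProd m n) = 0 := by
  rw [uvProd, map_prod]
  refine Finset.prod_eq_zero (Finset.mem_univ (Fin.last m)) ?_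
  rw [map_prod]
  exact Finset.prod_eq_zero (Finset.mem_univ (Fin.last n)) (by simp)

lemma exists_eq_uvProd_mul {P : MvPolynomial (Fin (m + 1) ⊕ Fin (n + 1)) ℚ}
    (hP : IsSupersymmetric (m + 1) (n + 1) P) (h0 : rho m n P = 0) :
    ∃ Q, IsBisymmetric (m + 1) (n + 1) Q ∧ P = uvProd m n * Q := by
  obtain ⟨hu, hv, hs⟩ := hP
  have hlast : X (Sum.inl (Fin.last m)) + X (Sum.inr (Fin.last n)) ∣ P := by
    obtain ⟨c, hc⟩ := hs (Fin.last m) (Fin.last n)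
    have h1 : ((Polynomial.aeval (0 : MvPolynomial (Fin (m + 1) ⊕ Fin (n + 1)) ℚ)).restrictScalars
        ℚ).comp (substT (m + 1) (n + 1) (Fin.last m) (Fin.last n)) =
        (rename (Sum.map Fin.castSucc Fin.castSucc)).comp (rho m n) := by
      ext (p | q) : 1
      · induction p using Fin.lastCases <;> simp [substT]
      · induction q using Fin.lastCases <;> simp [substT]
    have h2 : ((Polynomial.aeval (X (Sum.inl (Fin.last m)) :
        MvPolynomial (Fin (m + 1) ⊕ Fin (n + 1)) ℚ)).restrictScalars ℚ).comp
        (substT (m + 1) (n + 1) (Fin.last m) (Fin.last n)) =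
        substNeg (Fin.last m) (Fin.last n) := by
      ext (p | q) : 1
      · by_cases hp : p = Fin.last m <;> simp [substT, substNeg, hp]
      · by_cases hq : q = Fin.last n <;> simp [substT, substNeg, hq]
    have h1' := DFunLike.congr_fun h1 P
    have h2' := DFunLike.congr_fun h2 P
    simp only [AlgHom.comp_apply, hc, h0, map_zero, AlgHom.restrictScalars_apply,
      Polynomial.aeval_C, Algebra.algebraMap_self, RingHom.id_apply] at h1' h2'
    rw [X_add_X_dvd_iff, ← h2', h1']
  obtain ⟨Q, hQ⟩ := prod_X_add_X_dvd (P := P) fun i j => by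
    have h := map_dvd (rename (Sum.map (Equiv.swap (Fin.last m) i) id)) (map_dvd
      (rename (Sum.map id (Equiv.swap (Fin.last n) j))) hlast)
    rw [hv, hu] at h
    simpa using h
  obtain ⟨hu', hv'⟩ := isBisymmetric_prod_X_add_X (m := m + 1) (n := n + 1)
  refine ⟨Q, ⟨fun σ => ?_, fun τ => ?_⟩, hQ⟩
  · refine mul_left_cancel₀ prod_X_add_X_ne_zero ?_
    rw [← hQ, ← hu σ, hQ, map_mul, hu']
  · refine mul_left_cancel₀ prod_X_add_X_ne_zero ?_
    rw [← hQ, ← hv τ, hQ, map_mul, hv']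

end Divisibility

section Generation

open MvPolynomial

variable {m n : ℕ}

lemma det_jacobiTrudi_mem (κ : Fin n → ℕ) :
    (jacobiTrudi (fun i : Fin m => (X (Sum.inl i) : MvPolynomial (Fin m ⊕ Fin n) ℚ))
      (fun j => X (Sum.inr j)) κ).det ∈ elementarySubalgebra m n := by
  rw [Matrix.det_apply]
  refine sum_mem fun σ _ => ?_
  rw [Units.smul_def]
  refine zsmul_mem (prod_mem fun i _ => ?_) _
  rw [jacobiTrudi, Matrix.of_apply, PowerSeries.coeff_X_pow_mul']
  split_ifs
  · exact superElementary_mem _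
  · exact zero_mem _

/-- The antisymmetrization of a polynomial. -/
noncomputable def antisymmetrize (n : ℕ) : MvPolynomial (Fin n) ℚ →ₗ[ℚ] MvPolynomial (Fin n) ℚ :=
  ∑ τ : Equiv.Perm (Fin n), (Equiv.Perm.sign τ : ℤ) • (rename τ).toLinearMap

lemma antisymmetrize_apply (P : MvPolynomial (Fin n) ℚ) :
    antisymmetrize n P = ∑ τ : Equiv.Perm (Fin n), (Equiv.Perm.sign τ : ℤ) • rename τ P := by
  simp [antisymmetrize]

lemma antisymmetrize_monomial (κ : Fin n →₀ ℕ) (c : ℚ) :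
    antisymmetrize n (monomial κ c) =
      c • (Matrix.of fun i l => (X l : MvPolynomial (Fin n) ℚ) ^ κ i).det := by
  rw [antisymmetrize_apply, ← Matrix.det_transpose, Matrix.det_apply, Finset.smul_sum]
  refine Finset.sum_congr rfl fun τ _ => ?_
  rw [Units.smul_def, smul_comm, monomial_eq, Finsupp.prod_fintype _ _ (by simp), map_mul,
    rename_C, map_prod, smul_eq_C_mul]
  simp

lemma antisymmetrize_symmetric_mul_vandermonde {P : MvPolynomial (Fin n) ℚ} (hP : P.IsSymmetric) :
    antisymmetrize n (P * (Matrix.vandermonde X).det) =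
      (n.factorial : ℚ) • (P * (Matrix.vandermonde X).det) := by
  rw [antisymmetrize_apply]
  have h (τ : Equiv.Perm (Fin n)) : (Equiv.Perm.sign τ : ℤ) • rename τ
      (P * (Matrix.vandermonde (X : Fin n → MvPolynomial (Fin n) ℚ)).det) =
        P * (Matrix.vandermonde X).det := by
    have hV : rename τ (Matrix.vandermonde (X : Fin n → MvPolynomial (Fin n) ℚ)).det =
        (Equiv.Perm.sign τ : ℤ) • (Matrix.vandermonde X).det := by
      have h2 := Matrix.det_permute τ (Matrix.vandermonde (X : Fin n → MvPolynomial (Fin n) ℚ))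
      rw [zsmul_eq_mul, ← h2, AlgHom.map_det]
      congr 1
      ext i j : 2
      simp [Matrix.vandermonde_apply]
    rw [map_mul, hP τ, hV, mul_smul_comm, smul_smul, ← Units.val_mul, Int.units_mul_self,
      Units.val_one, one_smul]
  simp_rw [h]
  rw [Finset.sum_const, Finset.card_univ, Fintype.card_perm, Fintype.card_fin,
    Nat.cast_smul_eq_nsmul]

lemma rename_vandermonde_ne_zero :
    (rename Sum.inr (Matrix.vandermonde (X : Fin n → MvPolynomial (Fin n) ℚ)).det :
      MvPolynomial (Fin m ⊕ Fin n) ℚ) ≠ 0 := by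
  rw [Ne, map_eq_zero_iff _ (rename_injective _ Sum.inr_injective)]
  exact Matrix.det_vandermonde_ne_zero_iff.2 (X_injective (R := ℚ))

lemma exists_mem_prod_mul_antisymmetrize (P : MvPolynomial (Fin n) ℚ) :
    ∃ a ∈ elementarySubalgebra m n,
      (∏ i : Fin m, ∏ j : Fin n, (X (Sum.inl i) + X (Sum.inr j))) *
        rename Sum.inr (antisymmetrize n P) =
      a * rename Sum.inr (Matrix.vandermonde X).det := by
  induction P using MvPolynomial.induction_on' with
  | monomial κ c =>
    refine ⟨_, Subalgebra.smul_mem _ (det_jacobiTrudi_mem κ) c, ?_⟩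
    have h := det_jacobiTrudi_mul (fun i : Fin m => (X (Sum.inl i) : MvPolynomial _ ℚ))
      (fun j : Fin n => X (Sum.inr j)) κ
    have h1 : rename Sum.inr (Matrix.vandermonde (X : Fin n → MvPolynomial (Fin n) ℚ)).det =
        (prodEraseMatrix fun j : Fin n => (X (Sum.inr j) : MvPolynomial (Fin m ⊕ Fin n) ℚ)).det := by
      rw [det_prodEraseMatrix, AlgHom.map_det]
      congr 1
      ext i j : 2
      simp [Matrix.vandermonde_apply]
    have h2 : rename Sum.inr (Matrix.of fun i l => (X l : MvPolynomial (Fin n) ℚ) ^ κ i).det =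
        (Matrix.of fun i l => (X (Sum.inr l) : MvPolynomial (Fin m ⊕ Fin n) ℚ) ^ κ i).det := by
      rw [AlgHom.map_det]
      congr 1
      ext i j : 2
      simp
    rw [antisymmetrize_monomial, map_smul, mul_smul_comm, smul_mul_assoc, h1, h2, h]
  | add P Q hP hQ =>
    obtain ⟨a, ha, hPa⟩ := hP
    obtain ⟨b, hb, hQb⟩ := hQ
    exact ⟨a + b, add_mem ha hb, by rw [map_add, map_add, mul_add, hPa, hQb, add_mul]⟩

lemma prod_mul_rename_mem {P : MvPolynomial (Fin n) ℚ} (hP : P.IsSymmetric) :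
    (∏ i : Fin m, ∏ j : Fin n, (X (Sum.inl i) + X (Sum.inr j))) * rename Sum.inr P ∈
      elementarySubalgebra m n := by
  obtain ⟨a, ha, h⟩ := exists_mem_prod_mul_antisymmetrize (m := m)
    (P * (Matrix.vandermonde X).det)
  rw [antisymmetrize_symmetric_mul_vandermonde hP, map_smul, map_mul, mul_smul_comm,
    ← mul_assoc, ← smul_mul_assoc] at h
  have h' := mul_right_cancel₀ rename_vandermonde_ne_zero h
  have hn : (n.factorial : ℚ) ≠ 0 := by exact_mod_cast n.factorial_ne_zero
  rw [← inv_smul_smul₀ hn (_ * rename Sum.inr P), h']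
  exact Subalgebra.smul_mem _ ha _

/-- The symmetric polynomials in the `u`'s. -/
noncomputable def uSubalgebra (m n : ℕ) : Subalgebra ℚ (MvPolynomial (Fin m ⊕ Fin n) ℚ) :=
  (symmetricSubalgebra (Fin m) ℚ).map (rename Sum.inl)

/-- The symmetric polynomials in the `v`'s. -/
noncomputable def vSubalgebra (m n : ℕ) : Subalgebra ℚ (MvPolynomial (Fin m ⊕ Fin n) ℚ) :=
  (symmetricSubalgebra (Fin n) ℚ).map (rename Sum.inr)

lemma isSymmetric_sum_rename {σ : Type*} [Fintype σ] [DecidableEq σ] (P : MvPolynomial σ ℚ) :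
    (∑ τ : Equiv.Perm σ, rename τ P).IsSymmetric := by
  intro e
  simp only [map_sum, rename_rename]
  exact Equiv.sum_comp (Equiv.mulLeft e) fun τ : Equiv.Perm σ => rename τ P

lemma sum_sum_rename_mem (P : MvPolynomial (Fin m ⊕ Fin n) ℚ) :
    ∑ σ : Equiv.Perm (Fin m), ∑ τ : Equiv.Perm (Fin n), rename (Sum.map σ τ) P ∈
      uSubalgebra m n ⊔ vSubalgebra m n := by
  induction P using MvPolynomial.induction_on' with
  | monomial κ c =>
    obtain ⟨P, Q, h⟩ : ∃ (P : MvPolynomial (Fin m) ℚ) (Q : MvPolynomial (Fin n) ℚ),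
        monomial κ c = rename Sum.inl P * rename Sum.inr Q := by
      refine ⟨C c * ∏ i, X i ^ κ (Sum.inl i), ∏ j, X j ^ κ (Sum.inr j), ?_⟩
      rw [monomial_eq, Finsupp.prod_fintype _ _ (by simp), Fintype.prod_sum_type]
      simp [mul_assoc]
    have h' : ∑ σ : Equiv.Perm (Fin m), ∑ τ : Equiv.Perm (Fin n),
        rename (Sum.map σ τ) (monomial κ c) =
        rename Sum.inl (∑ σ : Equiv.Perm (Fin m), rename σ P) *
          rename Sum.inr (∑ τ : Equiv.Perm (Fin n), rename τ Q) := by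
      simp only [h, map_sum, Finset.sum_mul_sum, map_mul, rename_rename]
      rfl
    rw [h']
    exact mul_mem
      ((le_sup_left : uSubalgebra m n ≤ _) ⟨_, isSymmetric_sum_rename P, rfl⟩)
      ((le_sup_right : vSubalgebra m n ≤ _) ⟨_, isSymmetric_sum_rename Q, rfl⟩)
  | add P Q hP hQ =>
    simp only [map_add, Finset.sum_add_distrib]
    exact add_mem hP hQ

lemma IsBisymmetric.mem_sup {P : MvPolynomial (Fin m ⊕ Fin n) ℚ} (hP : IsBisymmetric m n P) :
    P ∈ uSubalgebra m n ⊔ vSubalgebra m n := by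
  have h (σ : Equiv.Perm (Fin m)) (τ : Equiv.Perm (Fin n)) : rename (Sum.map σ τ) P = P := by
    have h' := hP.1 σ
    rw [← hP.2 τ, rename_rename, Sum.map_comp_map] at h'
    simpa [hP.2 τ] using h'
  have hmem := sum_sum_rename_mem P
  simp only [h, Finset.sum_const, Finset.card_univ, Fintype.card_perm, Fintype.card_fin,
    smul_smul, ← Nat.cast_smul_eq_nsmul ℚ] at hmem
  have hne : ((m.factorial : ℚ) * n.factorial) ≠ 0 := by positivity
  rw [← inv_smul_smul₀ hne P]
  exact Subalgebra.smul_mem _ hmem _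

lemma coeff_prod_one_sub_mem (k : ℕ) :
    PowerSeries.coeff k (∏ j : Fin n, (1 - PowerSeries.C (X (Sum.inr j) :
      MvPolynomial (Fin m ⊕ Fin n) ℚ) * PowerSeries.X)) ∈ vSubalgebra m n := by
  have h := coeff_prod_one_add (fun j : Fin n =>
    -(X (Sum.inr j) : MvPolynomial (Fin m ⊕ Fin n) ℚ)) k
  simp only [map_neg, neg_mul, ← sub_eq_add_neg] at h
  rw [h]
  refine ⟨(-1 : ℚ) ^ k • esymm (Fin n) ℚ k,
    Subalgebra.smul_mem _ (esymm_isSymmetric _ _ k) _, ?_⟩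
  simp only [RingHom.coe_coe, map_smul, esymm,
    map_sum, map_prod, rename_X, Finset.smul_sum]
  refine Finset.sum_congr rfl fun t ht => ?_
  rw [Finset.prod_neg, (Finset.mem_powersetCard.1 ht).2, smul_eq_C_mul]
  simp

lemma uSubalgebra_le : uSubalgebra m n ≤ elementarySubalgebra m n ⊔ vSubalgebra m n := by
  have hesymm (k : ℕ) : rename Sum.inl (esymm (Fin m) ℚ k) ∈
      elementarySubalgebra m n ⊔ vSubalgebra m n := by
    have h := coeff_prod_one_add (fun i : Fin m =>
      (X (Sum.inl i) : MvPolynomial (Fin m ⊕ Fin n) ℚ)) k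
    rw [← superGen_mul_prod _ fun j : Fin n => X (Sum.inr j), PowerSeries.coeff_mul] at h
    simp only [esymm, map_sum, map_prod, rename_X]
    rw [← h]
    exact sum_mem fun p _ => mul_mem
      ((le_sup_left : elementarySubalgebra m n ≤ _) (superElementary_mem _))
      ((le_sup_right : vSubalgebra m n ≤ _) (coeff_prod_one_sub_mem _))
  rintro _ ⟨P, hP, rfl⟩
  obtain ⟨Q, hQ⟩ := esymmAlgHom_surjective (σ := Fin m) (n := m) ℚ (by simp) ⟨P, hP⟩
  have hQ' := congrArg Subtype.val hQ
  rw [esymmAlgHom_apply] at hQ'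
  simp only at hQ'
  rw [← hQ']
  change rename Sum.inl (aeval _ Q) ∈ _
  rw [← AlgHom.comp_apply, comp_aeval, aeval_def, eval₂_eq]
  refine sum_mem fun d _ => mul_mem (Subalgebra.algebraMap_mem _ _) (prod_mem fun i _ => ?_)
  exact pow_mem (hesymm _) _

lemma prod_mul_mem {Q : MvPolynomial (Fin m ⊕ Fin n) ℚ} (hQ : IsBisymmetric m n Q) :
    (∏ i : Fin m, ∏ j : Fin n, (X (Sum.inl i) + X (Sum.inr j))) * Q ∈
      elementarySubalgebra m n := by
  have h : Q ∈ elementarySubalgebra m n ⊔ vSubalgebra m n :=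
    (sup_le uSubalgebra_le le_sup_right : uSubalgebra m n ⊔ vSubalgebra m n ≤ _) hQ.mem_sup
  clear hQ
  rw [← Subalgebra.mem_toSubmodule, ← Subalgebra.mul_toSubmodule] at h
  induction h using Submodule.mul_induction_on' with
  | mem_mul_mem a ha b hb =>
    obtain ⟨P, hP, rfl⟩ := hb
    rw [mul_left_comm]
    exact mul_mem ha (prod_mul_rename_mem hP)
  | add x _ y _ hx hy =>
    rw [mul_add]
    exact add_mem hx hy

lemma IsSupersymmetric.mem_elementarySubalgebra (m n : ℕ) (P : MvPolynomial (Fin m ⊕ Fin n) ℚ)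
    (hP : IsSupersymmetric m n P) : P ∈ elementarySubalgebra m n := by
  induction m generalizing n with
  | zero => simpa using prod_mul_mem ⟨hP.1, hP.2.1⟩
  | succ m ih =>
    cases n with
    | zero => simpa using prod_mul_mem ⟨hP.1, hP.2.1⟩
    | succ n =>
      have h := ih n _ hP.rho
      rw [← map_rho_elementarySubalgebra] at h
      obtain ⟨a, ha, hPa⟩ := h
      obtain ⟨Q, hQ, hPQ⟩ := exists_eq_uvProd_mul
        ((supersymmetricSubalgebra (m + 1) (n + 1)).sub_mem hP (elementarySubalgebra_le ha))
        (by rw [map_sub]; exact sub_eq_zero.2 hPa.symm)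
      rw [← sub_add_cancel P a, hPQ]
      exact add_mem (prod_mul_mem hQ) ha

end Generation

/-- Statement 8, for `m + 1 ≥ 1` and `n + 1 ≥ 1` variables:
(i) `ρ` maps `Λ(m+1|n+1)` onto `Λ(m|n)`;
(ii) the kernel of the restriction of `ρ` to `Λ(m+1|n+1)` consists exactly of the
products `(∏_{i,j}(u_i + v_j)) · Q` with `Q` bisymmetric;
(iii) in particular, each such product is supersymmetric. -/
theorem stmt_8 (m n : ℕ) :
    (rho m n '' {P | IsSupersymmetric (m + 1) (n + 1) P} = {P | IsSupersymmetric m n P}) ∧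
    ({P | IsSupersymmetric (m + 1) (n + 1) P ∧ rho m n P = 0} =
      {P | ∃ Q, IsBisymmetric (m + 1) (n + 1) Q ∧ P = uvProd m n * Q}) ∧
    (∀ Q, IsBisymmetric (m + 1) (n + 1) Q →
      IsSupersymmetric (m + 1) (n + 1) (uvProd m n * Q)) := by
  refine ⟨Set.Subset.antisymm ?_ fun P hP => ?_, Set.Subset.antisymm ?_ ?_,
    fun Q => isSupersymmetric_uvProd_mul⟩
  · rintro _ ⟨P, hP, rfl⟩
    exact hP.rho
  · have h := IsSupersymmetric.mem_elementarySubalgebra m n P hP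
    rw [← map_rho_elementarySubalgebra] at h
    obtain ⟨a, ha, hPa⟩ := h
    exact ⟨a, elementarySubalgebra_le ha, hPa⟩
  · rintro P ⟨hP, h0⟩
    exact exists_eq_uvProd_mul hP h0
  · rintro _ ⟨Q, hQ, rfl⟩
    exact ⟨isSupersymmetric_uvProd_mul hQ, by rw [map_mul, rho_uvProd, zero_mul]⟩
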